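/- Let q be a real number with 0 < q < 1 and N a positive integer. Let A be the 2N×2N skew-symmetric matrix with entries a_{i,j} = ([j]_q - [i]_q) · q^{-(i+j+2)²/2} for 0 ≤ i, j ≤ 2N-1, where the power of q is a real power. Then Pf(A) = q^{-N(16N² + 6N + 5)/6} ∏_{n=0}^{N-1} (q²;q)_{2n}. (This is the Catalan–Hankel Pfaffian evaluation attached to the Stieltjes–Wigert moments q^{-(n+1)²/2}.) -/

import Mathlib

open scoped BigOperators

/-- The finite q-Pochhammer symbol `(a;q)_n = ∏_{k=0}^{n-1} (1 - a q^k)`. -/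
noncomputable def qPoch (a q : ℝ) (n : ℕ) : ℝ := ∏ k ∈ Finset.range n, (1 - a * q ^ k)

/-- The q-bracket `[j]_q = (1 - q^j)/(1 - q)`. -/
noncomputable def qBracket (q : ℝ) (j : ℕ) : ℝ := (1 - q ^ j) / (1 - q)

/-- The Pfaffian of a `2N × 2N` real matrix, defined by
`Pf(A) = (1/(2^N N!)) ∑_{σ ∈ S_{2N}} sgn(σ) ∏_{k=1}^{N} a_{σ(2k-1),σ(2k)}`. -/
noncomputable def pfaffian {N : ℕ} (A : Matrix (Fin (2 * N)) (Fin (2 * N)) ℝ) : ℝ :=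
  (1 / (2 ^ N * (Nat.factorial N : ℝ))) *
    ∑ σ : Equiv.Perm (Fin (2 * N)),
      ((Equiv.Perm.sign σ : ℤ) : ℝ) *
        ∏ k : Fin N,
          A (σ ⟨2 * (k : ℕ), by have := k.isLt; omega⟩)
            (σ ⟨2 * (k : ℕ) + 1, by have := k.isLt; omega⟩)

section PairPerm

variable {κ : Type*}

/-- The permutation of `κ × Fin 2` that permutes the pairs by `w.1` and acts inside them by
`w.2`. -/
def pairPerm (w : Equiv.Perm κ × (κ → Equiv.Perm (Fin 2))) : Equiv.Perm (κ × Fin 2) :=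
  (Equiv.prodCongrRight w.2).trans (Equiv.prodCongrLeft fun _ => w.1)

theorem pairPerm_apply (w : Equiv.Perm κ × (κ → Equiv.Perm (Fin 2))) (k : κ) (b : Fin 2) :
    pairPerm w (k, b) = (w.1 k, w.2 k b) := rfl

theorem pairPerm_injective : Function.Injective (pairPerm (κ := κ)) := by
  rintro ⟨π, τ⟩ ⟨π', τ'⟩ h
  have h' (k : κ) (b : Fin 2) : (π k, τ k b) = (π' k, τ' k b) := DFunLike.congr_fun h (k, b)
  refine Prod.ext (Equiv.ext fun k => (Prod.ext_iff.mp (h' k 0)).1)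
    (funext fun k => Equiv.ext fun b => (Prod.ext_iff.mp (h' k b)).2)

theorem exists_pairPerm_eq [Finite κ] {σ : Equiv.Perm (κ × Fin 2)}
    (h : ∀ k, (σ (k, 0)).1 = (σ (k, 1)).1) : ∃ w, pairPerm w = σ := by
  have hfst (k : κ) (b : Fin 2) : (σ (k, b)).1 = (σ (k, 0)).1 := by
    fin_cases b
    · rfl
    · exact (h k).symm
  have hsnd (k : κ) : Function.Injective fun b : Fin 2 => (σ (k, b)).2 := fun b c hbc =>
    (Prod.ext_iff.mp (σ.injective
      (Prod.ext ((hfst k b).trans (hfst k c).symm) hbc : σ (k, b) = σ (k, c)))).2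
  have hπ : Function.Injective fun k => (σ (k, 0)).1 := fun k l hkl => by
    obtain ⟨b, hb⟩ := (Finite.injective_iff_surjective.mp (hsnd k)) (σ (l, 0)).2
    have : σ (k, b) = σ (l, 0) := Prod.ext ((hfst k b).trans hkl) hb
    exact (Prod.ext_iff.mp (σ.injective this)).1
  refine ⟨(Equiv.ofBijective _ (Finite.injective_iff_bijective.mp hπ),
    fun k => Equiv.ofBijective _ (Finite.injective_iff_bijective.mp (hsnd k))), ?_⟩
  ext1 ⟨k, b⟩
  exact Prod.ext (hfst k b).symm rfl

end PairPerm

/-- The unnormalized Pfaffian of a matrix indexed by `κ × Fin 2`, where `(k, 0)` and `(k, 1)`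
are the two members of the `k`-th pair. -/
def pfaffianSum {κ R : Type*} [Fintype κ] [DecidableEq κ] [CommRing R]
    (A : Matrix (κ × Fin 2) (κ × Fin 2) R) : R :=
  ∑ σ : Equiv.Perm (κ × Fin 2),
    ((Equiv.Perm.sign σ : ℤ) : R) * ∏ k : κ, A (σ (k, 0)) (σ (k, 1))

section PfaffianSum

variable {κ R : Type*} [Fintype κ] [DecidableEq κ] [CommRing R]

theorem pfaffianSum_congruence (A B : Matrix (κ × Fin 2) (κ × Fin 2) R) :
    pfaffianSum (B * A * B.transpose) = B.det * pfaffianSum A := by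
  have expand (σ : Equiv.Perm (κ × Fin 2)) :
      ∏ k : κ, (B * A * B.transpose) (σ (k, 0)) (σ (k, 1)) =
        ∑ F : κ × Fin 2 → κ × Fin 2,
          (∏ k : κ, A (F (k, 0)) (F (k, 1))) * ∏ x, B (σ x) (F x) := by
    have entry (k : κ) : (B * A * B.transpose) (σ (k, 0)) (σ (k, 1)) =
        ∑ f : Fin 2 → κ × Fin 2, A (f 0) (f 1) * (B (σ (k, 0)) (f 0) * B (σ (k, 1)) (f 1)) := by
      rw [← (finTwoArrowEquiv (κ × Fin 2)).symm.sum_comp, Fintype.sum_prod_type_right]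
      simp only [Matrix.mul_apply, Matrix.transpose_apply, Finset.sum_mul]
      refine Finset.sum_congr rfl fun b _ => Finset.sum_congr rfl fun a _ => ?_
      simp [finTwoArrowEquiv]
      ring
    simp only [entry, Finset.prod_univ_sum, Fintype.piFinset_univ]
    rw [← (Equiv.curry κ (Fin 2) (κ × Fin 2)).sum_comp]
    refine Finset.sum_congr rfl fun F _ => ?_
    rw [Finset.prod_mul_distrib, Fintype.prod_prod_type]
    simp [Fin.prod_univ_two]
  have alternating (F : κ × Fin 2 → κ × Fin 2) :
      ∑ σ : Equiv.Perm (κ × Fin 2), ((Equiv.Perm.sign σ : ℤ) : R) * ∏ x, B (σ x) (F x) =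
        (B.submatrix id F).det := by
    rw [Matrix.det_apply']
    rfl
  calc pfaffianSum (B * A * B.transpose)
      = ∑ F : κ × Fin 2 → κ × Fin 2,
          (∏ k : κ, A (F (k, 0)) (F (k, 1))) * (B.submatrix id F).det := by
        simp only [pfaffianSum, expand, Finset.mul_sum]
        rw [Finset.sum_comm]
        refine Finset.sum_congr rfl fun F _ => ?_
        rw [← alternating, Finset.mul_sum]
        refine Finset.sum_congr rfl fun σ _ => by ring
    _ = B.det * pfaffianSum A := by
        rw [pfaffianSum, Finset.mul_sum]
        symm
        refine Fintype.sum_of_injective (fun σ : Equiv.Perm (κ × Fin 2) => ⇑σ)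
          DFunLike.coe_injective _ _ (fun F hF => ?_) (fun σ => ?_)
        · have hinj : ¬ Function.Injective F := fun h =>
            hF ⟨Equiv.ofBijective F (Finite.injective_iff_bijective.mp h), rfl⟩
          simp only [Function.Injective, not_forall] at hinj
          obtain ⟨a, b, hab, hne⟩ := hinj
          rw [Matrix.det_zero_of_column_eq hne (fun i => by simp [hab]), mul_zero]
        · rw [Matrix.det_permute']
          ring

theorem sign_pairPerm (w : Equiv.Perm κ × (κ → Equiv.Perm (Fin 2))) :
    Equiv.Perm.sign (pairPerm w) = ∏ k, Equiv.Perm.sign (w.2 k) := by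
  rw [pairPerm, Equiv.Perm.sign_trans, Equiv.Perm.sign_prodCongrRight,
    Equiv.Perm.sign_prodCongrLeft]
  simp

theorem pfaffianSum_of_paired (T : Matrix (κ × Fin 2) (κ × Fin 2) R)
    (hskew : ∀ x y, T x y = -T y x)
    (hsupp : ∀ σ : Equiv.Perm (κ × Fin 2), (∀ k, T (σ (k, 0)) (σ (k, 1)) ≠ 0) →
      ∀ k, (σ (k, 0)).1 = (σ (k, 1)).1) :
    pfaffianSum T =
      (2 ^ Fintype.card κ * (Fintype.card κ).factorial : R) * ∏ k, T (k, 0) (k, 1) := by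
  have hconst : pfaffianSum T = ∑ _w : Equiv.Perm κ × (κ → Equiv.Perm (Fin 2)),
      ∏ k, T (k, 0) (k, 1) := by
    symm
    refine Fintype.sum_of_injective pairPerm pairPerm_injective _ _ (fun σ hσ => ?_)
      (fun w => ?_)
    · have : ¬ ∀ k, T (σ (k, 0)) (σ (k, 1)) ≠ 0 := fun hT =>
        hσ (exists_pairPerm_eq (hsupp σ hT))
      push Not at this
      obtain ⟨k, hk⟩ := this
      rw [Finset.prod_eq_zero (Finset.mem_univ k) hk, mul_zero]
    · rw [sign_pairPerm]
      push_cast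
      rw [← Finset.prod_mul_distrib, ← Equiv.prod_comp w.1]
      refine Finset.prod_congr rfl fun k _ => ?_
      rw [pairPerm_apply, pairPerm_apply]
      have hτ : ∀ τ : Equiv.Perm (Fin 2),
          τ = 1 ∨ τ = Equiv.swap 0 1 := by decide
      rcases hτ (w.2 k) with h | h
      · simp [h]
      · rw [h, Equiv.Perm.sign_swap (by decide), Equiv.swap_apply_left,
          Equiv.swap_apply_right, hskew (w.1 k, 1)]
        simp
  rw [hconst, Finset.sum_const, Finset.card_univ, Fintype.card_prod, Fintype.card_perm,
    Fintype.card_fun, Fintype.card_perm, Fintype.card_fin, nsmul_eq_mul]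
  push_cast
  simp [Nat.factorial]
  ring

end PfaffianSum

/-- The identification of `Fin N × Fin 2` with `Fin (2 * N)` sending `(k, b)` to `2 * k + b`. -/
def pairEquiv (N : ℕ) : Fin N × Fin 2 ≃ Fin (2 * N) :=
  finProdFinEquiv.trans (finCongr (Nat.mul_comm N 2))

theorem pairEquiv_val {N : ℕ} (x : Fin N × Fin 2) :
    (pairEquiv N x : ℕ) = 2 * (x.1 : ℕ) + (x.2 : ℕ) := by
  simp [pairEquiv, finProdFinEquiv, add_comm]

theorem pfaffian_eq_pfaffianSum {N : ℕ} (A : Matrix (Fin (2 * N)) (Fin (2 * N)) ℝ) :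
    pfaffian A = 1 / (2 ^ N * (Nat.factorial N : ℝ)) *
      pfaffianSum (A.submatrix (pairEquiv N) (pairEquiv N)) := by
  rw [pfaffian, pfaffianSum, ← (pairEquiv N).permCongr.sum_comp]
  congr 1
  refine Finset.sum_congr rfl fun σ _ => ?_
  rw [Equiv.Perm.sign_permCongr]
  congr 1
  refine Finset.prod_congr rfl fun k _ => ?_
  have h0 : (⟨2 * (k : ℕ), by have := k.isLt; omega⟩ : Fin (2 * N)) = pairEquiv N (k, 0) :=
    Fin.ext (by simp [pairEquiv_val])
  have h1 : (⟨2 * (k : ℕ) + 1, by have := k.isLt; omega⟩ : Fin (2 * N)) = pairEquiv N (k, 1) :=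
    Fin.ext (by simp [pairEquiv_val])
  rw [h0, h1]
  simp [Equiv.permCongr_apply]

theorem pfaffian_congruence {N : ℕ} (A B : Matrix (Fin (2 * N)) (Fin (2 * N)) ℝ) :
    pfaffian (B * A * B.transpose) = B.det * pfaffian A := by
  have h : (B * A * B.transpose).submatrix (pairEquiv N) (pairEquiv N) =
      B.submatrix (pairEquiv N) (pairEquiv N) * A.submatrix (pairEquiv N) (pairEquiv N) *
        (B.submatrix (pairEquiv N) (pairEquiv N)).transpose := by
    simp [Matrix.transpose_submatrix, Matrix.submatrix_mul_equiv]
  rw [pfaffian_eq_pfaffianSum, h, pfaffianSum_congruence, Matrix.det_submatrix_equiv_self,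
    pfaffian_eq_pfaffianSum]
  ring

/-- If a permutation of `{0, …, 2N-1}` puts neighbours into every pair, then the pairs are
`{2m, 2m+1}`. -/
theorem fst_eq_of_adjacent {N : ℕ} (σ : Equiv.Perm (Fin N × Fin 2))
    (h : ∀ k, (pairEquiv N (σ (k, 1)) : ℕ) = pairEquiv N (σ (k, 0)) + 1 ∨
      (pairEquiv N (σ (k, 0)) : ℕ) = pairEquiv N (σ (k, 1)) + 1) (k : Fin N) :
    (σ (k, 0)).1 = (σ (k, 1)).1 := by
  set v : Fin N × Fin 2 → ℕ := fun x => pairEquiv N (σ x) with hv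
  have v_inj : Function.Injective v :=
    Fin.val_injective.comp ((pairEquiv N).injective.comp σ.injective)
  have flip_ne (b : Fin 2) : 1 - b ≠ b := by revert b; decide
  have flip_flip (b : Fin 2) : 1 - (1 - b) = b := by revert b; decide
  have adj (l : Fin N) (b : Fin 2) : v (l, 1 - b) = v (l, b) + 1 ∨
      v (l, b) = v (l, 1 - b) + 1 := by
    fin_cases b
    · exact h l
    · exact (h l).symm
  have v_surj (m : ℕ) (hm : m < 2 * N) : ∃ x, v x = m :=
    ⟨σ.symm ((pairEquiv N).symm ⟨m, hm⟩), by simp [hv]⟩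
  have v_lt (x) : v x < 2 * N := (pairEquiv N (σ x)).isLt
  have partner (m : ℕ) : ∀ l b, v (l, b) = 2 * m → v (l, 1 - b) = 2 * m + 1 := by
    induction m with
    | zero =>
      intro l b hb
      have := adj l b
      omega
    | succ m ih =>
      intro l b hb
      rcases adj l b with h1 | h1
      · omega
      · have hlt := v_lt (l, b)
        obtain ⟨⟨l', b'⟩, hl'⟩ := v_surj (2 * m) (by omega)
        have heq : v (l', 1 - b') = v (l, 1 - b) := by
          rw [ih l' b' hl']
          omega
        obtain ⟨hll, hb'⟩ := Prod.mk.inj (v_inj heq)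
        have hbb : b' = b := by
          rw [← flip_flip b', hb', flip_flip]
        subst hll
        subst hbb
        omega
  have hval (x) : v x = 2 * ((σ x).1 : ℕ) + ((σ x).2 : ℕ) := pairEquiv_val (σ x)
  have e0 := hval (k, 0)
  have e1 := hval (k, 1)
  have l0 := (σ (k, 0)).2.isLt
  have l1 := (σ (k, 1)).2.isLt
  have p0 := partner (σ (k, 0)).1 k 0
  have p1 := partner (σ (k, 1)).1 k 1
  simp only [sub_zero, sub_self] at p0 p1
  have := adj k 0
  simp only [sub_zero] at this
  exact Fin.ext (by omega)

/-- The skew-symmetric tridiagonal matrix with superdiagonal `t`. -/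
def skewTridiagonal {R : Type*} [Ring R] (t : ℕ → R) (i j : ℕ) : R :=
  (if j = i + 1 then t i else 0) - (if i = j + 1 then t j else 0)

theorem pfaffian_skewTridiagonal {N : ℕ} (t : ℕ → ℝ) :
    pfaffian (Matrix.of fun i j : Fin (2 * N) => skewTridiagonal t i j) =
      ∏ n ∈ Finset.range N, t (2 * n) := by
  rw [pfaffian_eq_pfaffianSum, pfaffianSum_of_paired]
  · rw [Fintype.card_fin, ← mul_assoc, one_div, inv_mul_cancel₀ (by positivity), one_mul,
      ← Fin.prod_univ_eq_prod_range (fun n => t (2 * n))]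
    refine Finset.prod_congr rfl fun k _ => ?_
    simp [skewTridiagonal, pairEquiv_val]
    omega
  · intro x y
    simp [skewTridiagonal]
  · intro σ hσ
    refine fst_eq_of_adjacent σ fun k => ?_
    by_contra hk
    push Not at hk
    exact hσ k (by simp [skewTridiagonal, hk.1, hk.2])

theorem sum_skewTridiagonal {R : Type*} [CommRing R] (t f g : ℕ → R) (n : ℕ)
    (hf : f n = 0) (hg : g n = 0) :
    ∑ l ∈ Finset.range n, (∑ k ∈ Finset.range n, f k * skewTridiagonal t k l) * g l =
      ∑ k ∈ Finset.range n, t k * (f k * g (k + 1) - f (k + 1) * g k) := by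
  have collapse (f g : ℕ → R) (hg : g n = 0) :
      ∑ k ∈ Finset.range n, ∑ l ∈ Finset.range n, f k * (if l = k + 1 then t k else 0) * g l =
        ∑ k ∈ Finset.range n, t k * (f k * g (k + 1)) := by
    refine Finset.sum_congr rfl fun k hk => ?_
    simp only [mul_ite, ite_mul, mul_zero, zero_mul, Finset.sum_ite_eq', Finset.mem_range]
    split_ifs with h
    · ring
    · have : k + 1 = n := by
        have := Finset.mem_range.mp hk
        omega
      rw [this, hg]
      ring
  simp only [skewTridiagonal, mul_sub, sub_mul, Finset.sum_sub_distrib, Finset.sum_mul]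
  congr 1
  · rw [Finset.sum_comm, collapse f g hg]
  · rw [← Finset.sum_congr rfl fun k _ => congrArg (t k * ·) (mul_comm (g k) (f (k + 1))),
      ← collapse g f hf]
    exact Finset.sum_congr rfl fun l _ => Finset.sum_congr rfl fun k _ => by ring

/-- The Newton basis polynomial `∏_{r<k} (x - p^r)` at the nodes `1, p, p², …`. -/
def newtonGeom {R : Type*} [CommRing R] (p : R) (k : ℕ) (x : R) : R :=
  ∏ r ∈ Finset.range k, (x - p ^ r)

section NewtonGeom

variable {R : Type*} [CommRing R]

theorem newtonGeom_zero (p x : R) : newtonGeom p 0 x = 1 := by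
  simp [newtonGeom]

theorem newtonGeom_succ (p x : R) (k : ℕ) :
    newtonGeom p (k + 1) x = newtonGeom p k x * (x - p ^ k) := by
  simp [newtonGeom, Finset.prod_range_succ]

theorem newtonGeom_pow_eq_zero (p : R) {i k : ℕ} (h : i < k) :
    newtonGeom p k (p ^ i) = 0 :=
  Finset.prod_eq_zero (Finset.mem_range.mpr h) (sub_self _)

theorem newtonGeom_succ_pow_succ (p : R) (k j : ℕ) :
    newtonGeom p (k + 1) (p ^ (j + 1)) = (p ^ (j + 1) - 1) * p ^ k * newtonGeom p k (p ^ j) := by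
  simp only [newtonGeom]
  rw [Finset.prod_range_succ', pow_zero]
  have (r : ℕ) : p ^ (j + 1) - p ^ (r + 1) = p * (p ^ j - p ^ r) := by ring
  simp only [this, Finset.prod_mul_distrib, Finset.prod_const, Finset.card_range]
  ring

end NewtonGeom

section NewtonInterpolation

variable {K : Type*} [Field K]

theorem newtonGeom_pow_self_ne_zero {p : K} (hp0 : p ≠ 0) (hp : ∀ k, p ^ (k + 1) ≠ 1) (k : ℕ) :
    newtonGeom p k (p ^ k) ≠ 0 := by
  induction k with
  | zero => simp [newtonGeom_zero]
  | succ k ih =>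
    rw [newtonGeom_succ_pow_succ]
    exact mul_ne_zero (mul_ne_zero (sub_ne_zero.mpr (hp k)) (pow_ne_zero _ hp0)) ih

/-- The Cauchy binomial theorem: Newton interpolation of `x^j` at the nodes `1, p, p², …`. -/
theorem sum_newtonGeom {p : K} (hp0 : p ≠ 0) (hp : ∀ k, p ^ (k + 1) ≠ 1) (x : K) (j n : ℕ)
    (hjn : j < n) :
    ∑ k ∈ Finset.range n,
      newtonGeom p k x * (newtonGeom p k (p ^ j) / newtonGeom p k (p ^ k)) = x ^ j := by
  induction j generalizing n with
  | zero =>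
    rw [Finset.sum_eq_single_of_mem 0 (Finset.mem_range.mpr hjn)]
    · simp [newtonGeom_zero]
    · intro k _ hk
      rw [newtonGeom_pow_eq_zero p (Nat.pos_of_ne_zero hk)]
      simp
  | succ j ih =>
    obtain ⟨n, rfl⟩ : ∃ m, n = m + 1 := ⟨n - 1, by omega⟩
    have pascal (k : ℕ) :
        newtonGeom p (k + 1) (p ^ (j + 1)) / newtonGeom p (k + 1) (p ^ (k + 1)) =
          newtonGeom p k (p ^ j) / newtonGeom p k (p ^ k) + p ^ (k + 1) *
            (newtonGeom p (k + 1) (p ^ j) / newtonGeom p (k + 1) (p ^ (k + 1))) := by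
      have h1 := newtonGeom_pow_self_ne_zero hp0 hp k
      have h2 : p ^ (k + 1) - 1 ≠ 0 := sub_ne_zero.mpr (hp k)
      rw [newtonGeom_succ_pow_succ, newtonGeom_succ_pow_succ, newtonGeom_succ]
      field_simp
      ring
    have shift : ∑ k ∈ Finset.range n, newtonGeom p (k + 1) x * (p ^ (k + 1) *
          (newtonGeom p (k + 1) (p ^ j) / newtonGeom p (k + 1) (p ^ (k + 1)))) + 1 =
        ∑ k ∈ Finset.range n, newtonGeom p k x * (p ^ k *
          (newtonGeom p k (p ^ j) / newtonGeom p k (p ^ k))) := by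
      have h1 := Finset.sum_range_succ (fun k => newtonGeom p k x * (p ^ k *
          (newtonGeom p k (p ^ j) / newtonGeom p k (p ^ k)))) n
      rw [Finset.sum_range_succ', newtonGeom_pow_eq_zero p (by omega : j < n)] at h1
      simpa [newtonGeom_zero] using h1
    rw [Finset.sum_range_succ']
    simp only [pascal, newtonGeom_zero]
    simp only [mul_add, Finset.sum_add_distrib, div_one, mul_one]
    rw [add_assoc, shift, ← Finset.sum_add_distrib, pow_succ', ← ih n (by omega),
      Finset.mul_sum]
    refine Finset.sum_congr rfl fun k _ => ?_
    rw [newtonGeom_succ]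
    ring

end NewtonInterpolation

theorem det_diagonal_newtonGeom {R : Type*} [CommRing R] (p : R) (d : ℕ → R) (n : ℕ) :
    (Matrix.of fun i k : Fin n => d i * newtonGeom p k (p ^ (i : ℕ))).det =
      ∏ i ∈ Finset.range n, d i * newtonGeom p i (p ^ i) := by
  rw [Matrix.det_of_isLowerTriangular,
    ← Fin.prod_univ_eq_prod_range (fun i => d i * newtonGeom p i (p ^ i))]
  · rfl
  · intro i k hik
    have : (i : ℕ) < k := hik
    simp [newtonGeom_pow_eq_zero p this]

theorem pfaffian_geometric {p : ℝ} (hp0 : p ≠ 0) (hp : ∀ k, p ^ (k + 1) ≠ 1) (c : ℝ)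
    (d : ℕ → ℝ) (N : ℕ) :
    pfaffian (Matrix.of fun i j : Fin (2 * N) =>
        d i * d j * c * (p ^ (j : ℕ) - p ^ (i : ℕ)) * p ^ ((i : ℕ) * (j : ℕ))) =
      ∏ n ∈ Finset.range N, d (2 * n) * d (2 * n + 1) * c *
        newtonGeom p (2 * n + 1) (p ^ (2 * n + 1)) := by
  set B : Matrix (Fin (2 * N)) (Fin (2 * N)) ℝ :=
    Matrix.of fun i k => d i * newtonGeom p k (p ^ (i : ℕ)) with hB
  set T : Matrix (Fin (2 * N)) (Fin (2 * N)) ℝ :=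
    Matrix.of fun i j => skewTridiagonal (fun k => c / newtonGeom p k (p ^ k)) i j with hT
  have hfactor : (Matrix.of fun i j : Fin (2 * N) =>
      d i * d j * c * (p ^ (j : ℕ) - p ^ (i : ℕ)) * p ^ ((i : ℕ) * (j : ℕ))) =
      B * T * B.transpose := by
    ext i j
    simp only [Matrix.mul_apply, Matrix.transpose_apply, hB, hT, Matrix.of_apply]
    rw [Finset.sum_congr rfl fun l _ => by
      rw [Fin.sum_univ_eq_sum_range (fun k => d i * newtonGeom p k (p ^ (i : ℕ)) *
        skewTridiagonal (fun k => c / newtonGeom p k (p ^ k)) k l) (2 * N)],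
      Fin.sum_univ_eq_sum_range (fun l => (∑ k ∈ Finset.range (2 * N),
        d i * newtonGeom p k (p ^ (i : ℕ)) *
        skewTridiagonal (fun k => c / newtonGeom p k (p ^ k)) k l) *
        (d j * newtonGeom p l (p ^ (j : ℕ)))) (2 * N),
      sum_skewTridiagonal _ (fun k => d i * newtonGeom p k (p ^ (i : ℕ)))
        (fun k => d j * newtonGeom p k (p ^ (j : ℕ))) _
        (by rw [newtonGeom_pow_eq_zero p i.isLt, mul_zero])
        (by rw [newtonGeom_pow_eq_zero p j.isLt, mul_zero]),
      pow_mul, ← sum_newtonGeom hp0 hp (p ^ (i : ℕ)) j (2 * N) j.isLt, Finset.mul_sum]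
    refine Finset.sum_congr rfl fun k _ => ?_
    rw [newtonGeom_succ, newtonGeom_succ]
    ring
  rw [hfactor, pfaffian_congruence, hB, det_diagonal_newtonGeom, hT, pfaffian_skewTridiagonal]
  clear hfactor hB hT B T
  induction N with
  | zero => simp
  | succ N ih =>
    rw [Nat.mul_succ, Finset.prod_range_succ, Finset.prod_range_succ, Finset.prod_range_succ,
      Finset.prod_range_succ, ← ih]
    have := newtonGeom_pow_self_ne_zero hp0 hp (2 * N)
    field_simp

theorem newtonGeom_inv_pow_self {q : ℝ} (hq : q ≠ 0) (m : ℕ) :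
    newtonGeom q⁻¹ (m + 1) (q⁻¹ ^ (m + 1)) =
      (q ^ ((m + 1) ^ 2))⁻¹ * (1 - q) * qPoch (q ^ 2) q m := by
  induction m with
  | zero =>
    simp [newtonGeom, qPoch]
    field_simp
  | succ m ih =>
    rw [newtonGeom_succ_pow_succ, ih, qPoch, qPoch, Finset.prod_range_succ]
    have : q⁻¹ ^ (m + 1 + 1) - 1 = (q ^ (m + 1 + 1))⁻¹ * (1 - q ^ 2 * q ^ m) := by
      rw [inv_pow]
      field_simp
      ring
    rw [this, show (m + 1 + 1) ^ 2 = (m + 1) ^ 2 + (m + 1) + (m + 1 + 1) by ring, inv_pow]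
    field_simp
    ring

theorem pfaffian_stieltjesWigert (q : ℝ) (hq0 : 0 < q) (hq1 : q < 1) (N : ℕ) (hN : 0 < N) :
    pfaffian (fun i j : Fin (2 * N) =>
        (qBracket q (j : ℕ) - qBracket q (i : ℕ)) *
          q ^ (-((((i : ℕ) : ℝ) + ((j : ℕ) : ℝ) + 2) ^ 2) / 2)) =
      q ^ (-(N : ℝ) * (16 * (N : ℝ) ^ 2 + 6 * (N : ℝ) + 5) / 6) *
        ∏ n ∈ Finset.range N, qPoch (q ^ 2) q (2 * n) := by
  have hq : q ≠ 0 := hq0.ne'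
  have h1q : 1 - q ≠ 0 := by linarith
  have hp (k : ℕ) : q⁻¹ ^ (k + 1) ≠ 1 :=
    (one_lt_pow₀ ((one_lt_inv₀ hq0).mpr hq1) k.succ_ne_zero).ne'
  have hentry : (Matrix.of fun i j : Fin (2 * N) =>
      (qBracket q (j : ℕ) - qBracket q (i : ℕ)) *
        q ^ (-((((i : ℕ) : ℝ) + ((j : ℕ) : ℝ) + 2) ^ 2) / 2)) =
      Matrix.of fun i j : Fin (2 * N) => (fun m : ℕ => q ^ (-((m : ℝ) + 1) ^ 2 / 2)) i *
        (fun m : ℕ => q ^ (-((m : ℝ) + 1) ^ 2 / 2)) j * (q⁻¹ / (1 - q)) *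
        (q⁻¹ ^ (j : ℕ) - q⁻¹ ^ (i : ℕ)) * q⁻¹ ^ ((i : ℕ) * (j : ℕ)) := by
    ext i j
    simp only [Matrix.of_apply]
    have hexp : -((((i : ℕ) : ℝ) + ((j : ℕ) : ℝ) + 2) ^ 2) / 2 =
        -(((i : ℕ) : ℝ) + 1) ^ 2 / 2 + -(((j : ℕ) : ℝ) + 1) ^ 2 / 2 -
          (((i : ℕ) * (j : ℕ) + i + j + 1 : ℕ) : ℝ) := by
      push_cast
      ring
    rw [hexp, Real.rpow_sub hq0, Real.rpow_add hq0, Real.rpow_natCast]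
    simp only [qBracket, inv_pow, pow_add]
    field_simp
    ring
  refine (congrArg pfaffian hentry).trans ?_
  rw [pfaffian_geometric (inv_ne_zero hq) hp _ fun m : ℕ => q ^ (-((m : ℝ) + 1) ^ 2 / 2)]
  clear hentry hN
  induction N with
  | zero => simp
  | succ N ih =>
    rw [Finset.prod_range_succ, Finset.prod_range_succ, ih, newtonGeom_inv_pow_self hq]
    have hexp : -((N + 1 : ℕ) : ℝ) * (16 * ((N + 1 : ℕ) : ℝ) ^ 2 + 6 * ((N + 1 : ℕ) : ℝ) + 5) / 6 =
        -(N : ℝ) * (16 * (N : ℝ) ^ 2 + 6 * (N : ℝ) + 5) / 6 +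
          -(((2 * N : ℕ) : ℝ) + 1) ^ 2 / 2 + -(((2 * N + 1 : ℕ) : ℝ) + 1) ^ 2 / 2 -
          (((2 * N + 1) ^ 2 + 1 : ℕ) : ℝ) := by
      push_cast
      ring
    rw [hexp, Real.rpow_sub hq0, Real.rpow_add hq0, Real.rpow_add hq0, Real.rpow_natCast,
      pow_succ q ((2 * N + 1) ^ 2)]
    field_simp
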